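/- arXiv:2605.14324 — 9 statements merged into one kernel-verified Lean document; each statement's English description precedes it below -/
import Mathlib

section
/- Let q ≥ 1, let A ⊆ ℝ^q be a convex set, let η > 0, and let y, y' ∈ A and w, w' ∈ ℝ^q satisfy the support conditions ⟨w, u − y⟩ ≥ 0 for all u ∈ A and ⟨w', u − y'⟩ ≥ 0 for all u ∈ A, where ⟨·,·⟩ is the Euclidean inner product. Define the deviation vectors α := y − η w and α' := y' − η w'. Then 0 ≤ ⟨w', y − y'⟩ ≤ ‖α − α'‖₂² / (2η), where ‖·‖₂ is the Euclidean norm on ℝ^q. -/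
/-- Euclidean inner product on `Fin q → ℝ`. -/
def inner2 (q : ℕ) (x y : Fin q → ℝ) : ℝ := ∑ i, x i * y i

/-- Euclidean norm on `Fin q → ℝ`. -/
noncomputable def norm2 (q : ℕ) (x : Fin q → ℝ) : ℝ := Real.sqrt (∑ i, (x i) ^ 2)

/-- Euclidean hyperplane distance bound via deviation vectors. -/
theorem stmt_0 (q : ℕ) (hq : 1 ≤ q) (A : Set (Fin q → ℝ)) (hA : Convex ℝ A)
    (η : ℝ) (hη : 0 < η) (y y' w w' : Fin q → ℝ)
    (hy : y ∈ A) (hy' : y' ∈ A)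
    (hw : ∀ u ∈ A, 0 ≤ inner2 q w (u - y))
    (hw' : ∀ u ∈ A, 0 ≤ inner2 q w' (u - y')) :
    0 ≤ inner2 q w' (y - y') ∧
      inner2 q w' (y - y') ≤ (norm2 q ((y - η • w) - (y' - η • w'))) ^ 2 / (2 * η) := by
  refine ⟨hw' y hy, ?_⟩
  have h := hw y' hy'
  have hsq : 0 ≤ ∑ i, (((y - η • w) - (y' - η • w')) i) ^ 2 :=
    Finset.sum_nonneg fun i _ => sq_nonneg _
  have hterm : 2 * η * inner2 q w' (y - y') + 2 * η * inner2 q w (y' - y) ≤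
      ∑ i, (((y - η • w) - (y' - η • w')) i) ^ 2 := by
    simp only [inner2, Finset.mul_sum, ← Finset.sum_add_distrib]
    refine Finset.sum_le_sum fun i _ => ?_
    simp only [Pi.sub_apply, Pi.smul_apply, smul_eq_mul]
    linarith [sq_nonneg (y i - y' i), sq_nonneg (η * (w i - w' i))]
  rw [norm2, Real.sq_sqrt hsq, le_div_iff₀ (by positivity)]
  linarith [mul_nonneg (mul_nonneg zero_le_two hη.le) h]
end

section
/- Let p ∈ (1,∞), q ≥ 1, let A ⊆ ℝ^q be a convex set, let η > 0, and let y, y' ∈ A and w, w' ∈ ℝ^q satisfy ⟨w, u − y⟩ ≥ 0 for all u ∈ A and ⟨w', u − y'⟩ ≥ 0 for all u ∈ A. Define α := y − η w and α' := y' − η w'. Then ⟨w', y − y'⟩ ≤ C(p,q) · ‖α − α'‖_p² / η, where C(p,q) := q^{1−2/p}/2 if p ≥ 2 and C(p,q) := 1/2 if 1 < p ≤ 2. -/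
/-- The ℓ_p norm on `Fin q → ℝ`. -/
noncomputable def lpNorm (p : ℝ) (q : ℕ) (x : Fin q → ℝ) : ℝ := (∑ i, |x i| ^ p) ^ (1 / p)

/-- For nonnegative reals and `1 ≤ r`, the sum of `r`-th powers is at most the `r`-th power of
the sum. -/
theorem sum_rpow_le_rpow_sum {ι : Type*} (s : Finset ι) (f : ι → ℝ) (hf : ∀ i ∈ s, 0 ≤ f i)
    {r : ℝ} (hr : 1 ≤ r) : ∑ i ∈ s, f i ^ r ≤ (∑ i ∈ s, f i) ^ r := by
  have split (t : ℝ) (ht : 0 ≤ t) : t ^ r = t * t ^ (r - 1) := by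
    rw [← Real.rpow_one_add' ht (by linarith), add_sub_cancel]
  rw [split _ (Finset.sum_nonneg hf), Finset.sum_mul]
  refine Finset.sum_le_sum fun i hi => ?_
  rw [split _ (hf i hi)]
  exact mul_le_mul_of_nonneg_left (Real.rpow_le_rpow (hf i hi)
    (Finset.single_le_sum hf hi) (by linarith)) (hf i hi)

theorem lpNorm_sq {p : ℝ} (q : ℕ) (x : Fin q → ℝ) :
    lpNorm p q x ^ 2 = (∑ i, |x i| ^ p) ^ (2 / p) := by
  have hS : 0 ≤ ∑ i, |x i| ^ p := by positivity
  rw [lpNorm, ← Real.rpow_natCast, ← Real.rpow_mul hS]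
  congr 1
  push_cast
  ring

theorem inner2_self_nonneg (q : ℕ) (x : Fin q → ℝ) : 0 ≤ inner2 q x x :=
  Finset.sum_nonneg fun i _ => mul_self_nonneg (x i)

theorem inner2_self_le_lpNorm_sq {p : ℝ} (hp : 0 < p) (hp2 : p ≤ 2) (q : ℕ) (x : Fin q → ℝ) :
    inner2 q x x ≤ lpNorm p q x ^ 2 := by
  rw [lpNorm_sq]
  refine le_trans (le_of_eq ?_) (sum_rpow_le_rpow_sum Finset.univ (fun i => |x i| ^ p)
    (fun i _ => by positivity) ((one_le_div hp).2 hp2))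
  refine Finset.sum_congr rfl fun i _ => ?_
  rw [← Real.rpow_mul (abs_nonneg _), mul_div_cancel₀ _ hp.ne', Real.rpow_two, sq_abs, sq]

theorem inner2_self_le_rpow_mul_lpNorm_sq {p : ℝ} (hp : 2 ≤ p) (q : ℕ) (x : Fin q → ℝ) :
    inner2 q x x ≤ (q : ℝ) ^ (1 - 2 / p) * lpNorm p q x ^ 2 := by
  have hp0 : 0 < p := by linarith
  have hS : 0 ≤ ∑ i, |x i| ^ p := by positivity
  have holder : inner2 q x x ^ (p / 2) ≤ (q : ℝ) ^ (p / 2 - 1) * ∑ i, |x i| ^ p := by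
    have h := Real.rpow_sum_le_const_mul_sum_rpow_of_nonneg (s := Finset.univ)
      (f := fun i => x i * x i) (p := p / 2) (by linarith) (fun i _ => mul_self_nonneg (x i))
    rw [Finset.card_univ, Fintype.card_fin] at h
    refine h.trans_eq ?_
    congr 1
    refine Finset.sum_congr rfl fun i _ => ?_
    rw [← sq, ← sq_abs, ← Real.rpow_two, ← Real.rpow_mul (abs_nonneg _),
      mul_div_cancel₀ _ two_ne_zero]
  have h := Real.rpow_le_rpow (Real.rpow_nonneg (inner2_self_nonneg q x) _) holder
    (by positivity : 0 ≤ 2 / p)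
  rw [← Real.rpow_mul (inner2_self_nonneg q x), Real.mul_rpow (by positivity) hS,
    ← Real.rpow_mul (by positivity), show p / 2 * (2 / p) = 1 by field_simp, Real.rpow_one,
    show (p / 2 - 1) * (2 / p) = 1 - 2 / p by field_simp] at h
  rwa [lpNorm_sq]

theorem mul_inner2_le_inner2_self_div_two (q : ℕ) {η : ℝ} (hη : 0 ≤ η) (y y' w w' : Fin q → ℝ)
    (h : 0 ≤ inner2 q w (y' - y)) :
    η * inner2 q w' (y - y') ≤
      inner2 q ((y - η • w) - (y' - η • w')) ((y - η • w) - (y' - η • w')) / 2 := by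
  refine (le_add_of_nonneg_right (mul_nonneg hη h)).trans ?_
  simp only [inner2, Finset.mul_sum, Finset.sum_div, ← Finset.sum_add_distrib]
  refine Finset.sum_le_sum fun i _ => ?_
  simp only [Pi.sub_apply, Pi.smul_apply, smul_eq_mul]
  nlinarith [sq_nonneg (y i - y' i), sq_nonneg (η * (w i - w' i))]

/-- ℓ_p hyperplane distance bound with constant
`C(p,q) = q^(1-2/p)/2` for `p ≥ 2` and `1/2` for `1 < p ≤ 2`. -/
theorem stmt_1 (p : ℝ) (hp : 1 < p) (q : ℕ) (hq : 1 ≤ q)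
    (A : Set (Fin q → ℝ)) (hA : Convex ℝ A)
    (η : ℝ) (hη : 0 < η) (y y' w w' : Fin q → ℝ)
    (hy : y ∈ A) (hy' : y' ∈ A)
    (hw : ∀ u ∈ A, 0 ≤ inner2 q w (u - y))
    (hw' : ∀ u ∈ A, 0 ≤ inner2 q w' (u - y')) :
    inner2 q w' (y - y') ≤
      (if 2 ≤ p then (q : ℝ) ^ (1 - 2 / p) / 2 else 1 / 2) *
        (lpNorm p q ((y - η • w) - (y' - η • w'))) ^ 2 / η := by
  rw [le_div_iff₀ hη, mul_comm]
  refine (mul_inner2_le_inner2_self_div_two q hη.le y y' w w' (hw y' hy')).trans ?_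
  split_ifs with h2
  · linarith [inner2_self_le_rpow_mul_lpNorm_sq h2 q ((y - η • w) - (y' - η • w'))]
  · linarith [inner2_self_le_lpNorm_sq (by linarith) (not_le.1 h2).le q
      ((y - η • w) - (y' - η • w'))]
end

section
/- Let p ∈ (1,∞), q ≥ 1, let A ⊆ ℝ^q be a convex set, let η > 0 and h > 0, and let y_i, y_j ∈ A and w_i, w_j ∈ ℝ^q satisfy ⟨w_i, u − y_i⟩ ≥ 0 for all u ∈ A and ⟨w_j, u − y_j⟩ ≥ 0 for all u ∈ A. Define α_i := y_i − η w_i and α_j := y_j − η w_j. If the hyperplane distance satisfies ⟨w_j, y_i − y_j⟩ ≥ h, then ‖α_i − α_j‖_p ≥ √(2ηh) / N_{2,p}, where N_{2,p} := q^{1/2−1/p} if p ≥ 2 and N_{2,p} := 1 if 1 < p ≤ 2. -/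
lemma sqrt_sum_sq_le_of_two_le (p : ℝ) (hp : 2 ≤ p) (q : ℕ) (x : Fin q → ℝ) :
    Real.sqrt (∑ i, x i ^ 2) ≤ lpNorm p q x * (q : ℝ) ^ ((1 : ℝ) / 2 - 1 / p) := by
  have hp0 : 0 < p := by linarith
  have hS : 0 ≤ ∑ i, |x i| ^ p := Finset.sum_nonneg fun i _ => by positivity
  have hT : 0 ≤ ∑ i, x i ^ 2 := Finset.sum_nonneg fun i _ => by positivity
  have hmean : (∑ i, x i ^ 2) ^ (p / 2) ≤ (q : ℝ) ^ (p / 2 - 1) * ∑ i, |x i| ^ p := by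
    have := Real.rpow_sum_le_const_mul_sum_rpow Finset.univ (fun i => x i ^ 2)
      (p := p / 2) (by linarith)
    simp only [Finset.card_univ, Fintype.card_fin, abs_sq] at this
    refine this.trans_eq ?_
    congr 1
    refine Finset.sum_congr rfl fun i _ => ?_
    rw [← sq_abs, ← Real.rpow_natCast, ← Real.rpow_mul (abs_nonneg _)]
    congr 1
    push_cast
    ring
  have hroot := Real.rpow_le_rpow (by positivity) hmean (z := 1 / p) (by positivity)
  rw [← Real.rpow_mul hT, Real.mul_rpow (by positivity) hS, ← Real.rpow_mul (by positivity)] at hroot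
  rw [Real.sqrt_eq_rpow, lpNorm, mul_comm]
  convert hroot using 2 <;> field_simp

lemma sqrt_sum_sq_le_of_le_two (p : ℝ) (hp0 : 0 < p) (hp : p ≤ 2) (q : ℕ) (x : Fin q → ℝ) :
    Real.sqrt (∑ i, x i ^ 2) ≤ lpNorm p q x := by
  have hterm : ∀ i, 0 ≤ |x i| ^ p := fun i => by positivity
  have hS : 0 ≤ ∑ i, |x i| ^ p := Finset.sum_nonneg fun i _ => hterm i
  have hexp : 0 ≤ 2 / p - 1 := by
    rw [sub_nonneg, le_div_iff₀ hp0]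
    linarith
  have split : ∀ a : ℝ, 0 ≤ a → a ^ (2 / p) = a * a ^ (2 / p - 1) := fun a ha => by
    rw [← Real.rpow_one_add' ha (by rw [add_sub_cancel]; positivity), add_sub_cancel]
  have hsum : ∑ i, x i ^ 2 ≤ (∑ i, |x i| ^ p) ^ (2 / p) := by
    rw [split _ hS, Finset.sum_mul]
    refine Finset.sum_le_sum fun i _ => ?_
    have hsq : x i ^ 2 = (|x i| ^ p) ^ (2 / p) := by
      rw [← Real.rpow_mul (abs_nonneg _), mul_div_cancel₀ _ hp0.ne', ← sq_abs]
      norm_cast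
    rw [hsq, split _ (hterm i)]
    exact mul_le_mul_of_nonneg_left (Real.rpow_le_rpow (hterm i)
      (Finset.single_le_sum (fun j _ => hterm j) (Finset.mem_univ i)) hexp) (hterm i)
  refine Real.sqrt_le_iff.2 ⟨Real.rpow_nonneg hS _, hsum.trans_eq ?_⟩
  rw [lpNorm, ← Real.rpow_natCast, ← Real.rpow_mul hS]
  congr 1
  push_cast
  ring

/-- deviation vector separation, part (i):
if the hyperplane distance is at least `h`, the deviation vectors are
`√(2ηh)/N_{2,p}`-separated in the ℓ_p norm. -/
theorem stmt_2 (p : ℝ) (hp : 1 < p) (q : ℕ) (hq : 1 ≤ q)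
    (A : Set (Fin q → ℝ)) (hA : Convex ℝ A)
    (η h : ℝ) (hη : 0 < η) (hh : 0 < h)
    (yi yj wi wj : Fin q → ℝ)
    (hyi : yi ∈ A) (hyj : yj ∈ A)
    (hwi : ∀ u ∈ A, 0 ≤ inner2 q wi (u - yi))
    (hwj : ∀ u ∈ A, 0 ≤ inner2 q wj (u - yj))
    (hd : h ≤ inner2 q wj (yi - yj)) :
    Real.sqrt (2 * η * h) / (if 2 ≤ p then (q : ℝ) ^ ((1 : ℝ) / 2 - 1 / p) else 1) ≤
      lpNorm p q ((yi - η • wi) - (yj - η • wj)) := by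
  have hsq : 2 * η * h ≤ ∑ i, ((yi - η • wi) - (yj - η • wj)) i ^ 2 := by
    have hexpand : ∑ i, ((yi - η • wi) - (yj - η • wj)) i ^ 2 =
        ∑ i, (yi i - yj i) ^ 2 + η ^ 2 * ∑ i, (wi i - wj i) ^ 2 +
          2 * η * (inner2 q wi (yj - yi) + inner2 q wj (yi - yj)) := by
      simp only [inner2, Finset.mul_sum, ← Finset.sum_add_distrib]
      refine Finset.sum_congr rfl fun i _ => ?_
      simp only [Pi.sub_apply, Pi.smul_apply, smul_eq_mul]
      ring
    have hdist : 0 ≤ ∑ i, (yi i - yj i) ^ 2 := Finset.sum_nonneg fun i _ => sq_nonneg _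
    have hdev : 0 ≤ η ^ 2 * ∑ i, (wi i - wj i) ^ 2 :=
      mul_nonneg (sq_nonneg _) (Finset.sum_nonneg fun i _ => sq_nonneg _)
    have hcross : 2 * η * h ≤ 2 * η * (inner2 q wi (yj - yi) + inner2 q wj (yi - yj)) :=
      mul_le_mul_of_nonneg_left (by linarith [hwi yj hyj]) (by positivity)
    linarith
  have hsqrt := Real.sqrt_le_sqrt hsq
  split_ifs with h2
  · have hq0 : (0 : ℝ) < q := by exact_mod_cast hq
    rw [div_le_iff₀ (Real.rpow_pos_of_pos hq0 _)]
    exact hsqrt.trans (sqrt_sum_sq_le_of_two_le p h2 q _)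
  · rw [div_one]
    exact hsqrt.trans (sqrt_sum_sq_le_of_le_two p (by linarith) (le_of_not_ge h2) q _)
end

section
/- Let q ≥ 1, let A ⊆ ℝ^q be a convex set, let η > 0 and c > 0, and let y_i, y_j ∈ A and w_i, w_j ∈ ℝ^q satisfy ⟨w_i, u − y_i⟩ ≥ 0 for all u ∈ A, ⟨w_j, u − y_j⟩ ≥ 0 for all u ∈ A, ‖w_i‖₂ ≥ c, ‖w_j‖₂ ≥ c, and ⟨w_i, w_j⟩ ≤ 0 (Euclidean inner product). Define α_i := y_i − η w_i and α_j := y_j − η w_j. Then ‖α_i − α_j‖₂ ≥ √2 · η · c. -/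
/-- deviation vector separation, part (ii): if the normals have
nonpositive Euclidean inner product and Euclidean norms at least `c`, then the
deviation vectors are `√2 · η · c`-separated in the Euclidean norm. -/
theorem stmt_3 (q : ℕ) (hq : 1 ≤ q) (A : Set (Fin q → ℝ)) (hA : Convex ℝ A)
    (η c : ℝ) (hη : 0 < η) (hc : 0 < c)
    (yi yj wi wj : Fin q → ℝ)
    (hyi : yi ∈ A) (hyj : yj ∈ A)
    (hwi : ∀ u ∈ A, 0 ≤ inner2 q wi (u - yi))
    (hwj : ∀ u ∈ A, 0 ≤ inner2 q wj (u - yj))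
    (hwic : c ≤ norm2 q wi) (hwjc : c ≤ norm2 q wj)
    (hij : inner2 q wi wj ≤ 0) :
    Real.sqrt 2 * η * c ≤ norm2 q ((yi - η • wi) - (yj - η • wj)) := by
  have hsq (w : Fin q → ℝ) (hw : c ≤ norm2 q w) : c ^ 2 ≤ ∑ i, w i ^ 2 :=
    (Real.le_sqrt' hc).mp hw
  have hexpand : ∑ k, ((yi - η • wi) - (yj - η • wj)) k ^ 2 =
      ∑ k, (yi - yj) k ^ 2 + 2 * η * (inner2 q wi (yj - yi) + inner2 q wj (yi - yj)) +
        η ^ 2 * (∑ k, wi k ^ 2 + ∑ k, wj k ^ 2 - 2 * inner2 q wi wj) := by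
    simp only [inner2, Finset.mul_sum, ← Finset.sum_add_distrib, ← Finset.sum_sub_distrib]
    refine Finset.sum_congr rfl fun k _ => ?_
    simp only [Pi.sub_apply, Pi.smul_apply, smul_eq_mul]
    ring
  have hcross : 0 ≤ 2 * η * (inner2 q wi (yj - yi) + inner2 q wj (yi - yj)) :=
    mul_nonneg (by positivity) (add_nonneg (hwi yj hyj) (hwj yi hyi))
  have hnormals : η ^ 2 * (2 * c ^ 2) ≤
      η ^ 2 * (∑ k, wi k ^ 2 + ∑ k, wj k ^ 2 - 2 * inner2 q wi wj) :=
    mul_le_mul_of_nonneg_left (by linarith [hsq wi hwic, hsq wj hwjc]) (sq_nonneg η)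
  have hdiff : 0 ≤ ∑ k, (yi - yj) k ^ 2 := Finset.sum_nonneg fun k _ => sq_nonneg _
  refine Real.le_sqrt_of_sq_le ?_
  rw [hexpand, mul_pow, mul_pow, Real.sq_sqrt zero_le_two]
  linarith
end

section
/- Let p ∈ (1,2] and q ≥ 1. For all x, y ∈ ℝ^q with ‖x‖_p = ‖y‖_p = 1 and all τ ≥ 0, (‖x + τ y‖_p + ‖x − τ y‖_p)/2 − 1 ≤ τ^p / p; that is, the modulus of smoothness of the ℓ_p norm satisfies ρ_p(τ) ≤ τ^p / p. -/
theorem abs_add_rpow_add_abs_sub_rpow_le {p : ℝ} (hp0 : 0 ≤ p) (hp2 : p ≤ 2) (a b : ℝ) :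
    |a + b| ^ p + |a - b| ^ p ≤ 2 * (|a| ^ p + |b| ^ p) := by
  have sq_rpow (c : ℝ) : (c ^ 2) ^ (p / 2) = |c| ^ p := by
    rw [← sq_abs, ← Real.rpow_natCast, ← Real.rpow_mul (abs_nonneg c)]
    congr 1
    push_cast
    ring
  have concave := (Real.concaveOn_rpow (p := p / 2) (by linarith) (by linarith)).2
    (Set.mem_Ici.2 (sq_nonneg (a + b))) (Set.mem_Ici.2 (sq_nonneg (a - b)))
    (by norm_num : (0 : ℝ) ≤ 1 / 2) (by norm_num : (0 : ℝ) ≤ 1 / 2) (by norm_num)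
  have subadd := Real.rpow_add_le_add_rpow (sq_nonneg a) (sq_nonneg b)
    (by linarith : 0 ≤ p / 2) (by linarith : p / 2 ≤ 1)
  have parallelogram : 1 / 2 * (a + b) ^ 2 + 1 / 2 * (a - b) ^ 2 = a ^ 2 + b ^ 2 := by ring
  simp only [smul_eq_mul, parallelogram, sq_rpow] at concave subadd
  linarith

theorem lpNorm_nonneg (p : ℝ) (q : ℕ) (x : Fin q → ℝ) : 0 ≤ lpNorm p q x := by
  unfold lpNorm
  positivity

theorem lpNorm_rpow {p : ℝ} (hp : p ≠ 0) (q : ℕ) (x : Fin q → ℝ) :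
    lpNorm p q x ^ p = ∑ i, |x i| ^ p := by
  rw [lpNorm, one_div, Real.rpow_inv_rpow (by positivity) hp]

theorem lpNorm_add_rpow_add_lpNorm_sub_rpow_le {p : ℝ} (hp0 : 0 < p) (hp2 : p ≤ 2) (q : ℕ)
    (x y : Fin q → ℝ) :
    lpNorm p q (x + y) ^ p + lpNorm p q (x - y) ^ p ≤
      2 * (lpNorm p q x ^ p + lpNorm p q y ^ p) := by
  simp only [lpNorm_rpow hp0.ne']
  rw [← Finset.sum_add_distrib, ← Finset.sum_add_distrib, Finset.mul_sum]
  exact Finset.sum_le_sum fun i _ => abs_add_rpow_add_abs_sub_rpow_le hp0.le hp2 (x i) (y i)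

theorem lpNorm_smul_rpow {p : ℝ} (hp : p ≠ 0) (q : ℕ) (c : ℝ) (x : Fin q → ℝ) :
    lpNorm p q (c • x) ^ p = |c| ^ p * lpNorm p q x ^ p := by
  simp only [lpNorm_rpow hp, Finset.mul_sum, Pi.smul_apply, smul_eq_mul, abs_mul,
    Real.mul_rpow (abs_nonneg _) (abs_nonneg _)]

/-- modulus-of-smoothness bound `ρ_p(τ) ≤ τ^p / p` for `1 < p ≤ 2`. -/
theorem stmt_10 (p : ℝ) (hp1 : 1 < p) (hp2 : p ≤ 2) (q : ℕ) (hq : 1 ≤ q)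
    (x y : Fin q → ℝ) (hx : lpNorm p q x = 1) (hy : lpNorm p q y = 1)
    (τ : ℝ) (hτ : 0 ≤ τ) :
    (lpNorm p q (x + τ • y) + lpNorm p q (x - τ • y)) / 2 - 1 ≤ τ ^ p / p := by
  have hp0 : 0 < p := by linarith
  set A := lpNorm p q (x + τ • y)
  set B := lpNorm p q (x - τ • y)
  have hA : 0 ≤ A := lpNorm_nonneg _ _ _
  have hB : 0 ≤ B := lpNorm_nonneg _ _ _
  have clarkson : A ^ p + B ^ p ≤ 2 * (1 + τ ^ p) := by
    simpa [lpNorm_smul_rpow hp0.ne', hx, hy, abs_of_nonneg hτ] using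
      lpNorm_add_rpow_add_lpNorm_sub_rpow_le hp0 hp2 q x (τ • y)
  have convex := (convexOn_rpow hp1.le).2 (Set.mem_Ici.2 hA) (Set.mem_Ici.2 hB)
    (by norm_num : (0 : ℝ) ≤ 1 / 2) (by norm_num : (0 : ℝ) ≤ 1 / 2) (by norm_num)
  simp only [smul_eq_mul] at convex
  have mean_rpow_le : ((A + B) / 2) ^ p ≤ 1 + τ ^ p := by
    rw [show (A + B) / 2 = 1 / 2 * A + 1 / 2 * B by ring]
    linarith
  have hτp : 0 ≤ τ ^ p := Real.rpow_nonneg hτ p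
  have mean_le : (A + B) / 2 ≤ (1 + τ ^ p) ^ p⁻¹ :=
    (Real.le_rpow_inv_iff_of_pos (by positivity) (by positivity) hp0).2 mean_rpow_le
  have bernoulli := rpow_one_add_le_one_add_mul_self (s := τ ^ p) (by linarith)
    (inv_nonneg.2 hp0.le) (inv_le_one_of_one_le₀ hp1.le)
  rw [div_eq_inv_mul (τ ^ p) p]
  linarith
end

section
/- Let p ∈ (1,2] and q ≥ 1. For all x, y ∈ ℝ^q with ‖x‖_p = ‖y‖_p = 1 and all ε ∈ [0,2] with ‖x − y‖_p ≥ ε, one has 1 − ‖(x + y)/2‖_p ≥ ((p−1)/8) ε²; that is, the modulus of convexity of the ℓ_p norm satisfies δ_p(ε) ≥ ((p−1)/8) ε². -/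
/-- Minkowski's inequality for a finite family of nonnegative vectors in the plane. -/
lemma rpow_add_rpow_sum_le {ι : Type*} (s : Finset ι) (a b : ι → ℝ) (ha : ∀ i, 0 ≤ a i)
    (hb : ∀ i, 0 ≤ b i) {r : ℝ} (hr : 1 ≤ r) :
    ((∑ i ∈ s, a i) ^ r + (∑ i ∈ s, b i) ^ r) ^ (1 / r) ≤
      ∑ i ∈ s, (a i ^ r + b i ^ r) ^ (1 / r) := by
  classical
  have hr0 : r ≠ 0 := by positivity
  induction s using Finset.induction_on with
  | empty => simp [Real.zero_rpow hr0, Real.zero_rpow (inv_ne_zero hr0)]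
  | insert i s hi ih =>
    rw [Finset.sum_insert hi, Finset.sum_insert hi, Finset.sum_insert hi]
    have h := Real.Lp_add_le_of_nonneg (s := (Finset.univ : Finset (Fin 2)))
      (f := ![a i, b i]) (g := ![∑ i ∈ s, a i, ∑ i ∈ s, b i]) hr
      (by simp [Fin.forall_fin_two, ha, hb])
      (by simp [Fin.forall_fin_two, Finset.sum_nonneg, ha, hb])
    simp only [Fin.sum_univ_two, Matrix.cons_val_zero, Matrix.cons_val_one] at h
    linarith

lemma two_mul_mul_le_rpow_sub_rpow {s t : ℝ} (hs0 : 0 < s) (hs1 : s ≤ 1) (ht0 : 0 ≤ t)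
    (ht1 : t ≤ 1) : 2 * s * t ≤ (1 + t) ^ s - (1 - t) ^ s := by
  have hmono : MonotoneOn (fun t : ℝ => (1 + t) ^ s - (1 - t) ^ s - 2 * s * t)
      (Set.Icc 0 1) := by
    have hd : ∀ u ∈ interior (Set.Icc (0 : ℝ) 1),
        HasDerivAt (fun t : ℝ => (1 + t) ^ s - (1 - t) ^ s - 2 * s * t)
          (s * ((1 + u) ^ (s - 1) + (1 - u) ^ (s - 1) - 2)) u := by
      intro u hu
      rw [interior_Icc] at hu
      have h1 := ((hasDerivAt_id u).const_add 1).rpow_const (p := s)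
        (Or.inl (by simp only [id]; linarith [hu.1]))
      have h2 := ((hasDerivAt_id u).const_sub 1).rpow_const (p := s)
        (Or.inl (by simp only [id]; linarith [hu.2]))
      have h3 := (hasDerivAt_id u).const_mul (2 * s)
      refine ((h1.sub h2).sub h3).congr_deriv ?_
      simp only [id]
      ring
    refine monotoneOn_of_hasDerivWithinAt_nonneg (convex_Icc 0 1) ?_
      (fun u hu => (hd u hu).hasDerivWithinAt) ?_
    · refine ContinuousOn.sub (ContinuousOn.sub ?_ ?_) (by fun_prop)
      · exact ContinuousOn.rpow_const (by fun_prop) (fun _ _ => Or.inr hs0.le)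
      · exact ContinuousOn.rpow_const (by fun_prop) (fun _ _ => Or.inr hs0.le)
    · intro u hu
      rw [interior_Icc] at hu
      have hu1 : 0 < 1 + u := by linarith [hu.1]
      have hu2 : 0 < 1 - u := by linarith [hu.2]
      have hprod : 1 ≤ (1 + u) ^ (s - 1) * (1 - u) ^ (s - 1) := by
        rw [← Real.mul_rpow hu1.le hu2.le]
        exact Real.one_le_rpow_of_pos_of_le_one_of_nonpos (by positivity)
          (by nlinarith [sq_nonneg u]) (by linarith)
      have hA := Real.rpow_pos_of_pos hu1 (s - 1)
      have hB := Real.rpow_pos_of_pos hu2 (s - 1)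
      refine mul_nonneg hs0.le ?_
      nlinarith [sq_nonneg ((1 + u) ^ (s - 1) - (1 - u) ^ (s - 1))]
  have h := hmono (by simp) (Set.mem_Icc.2 ⟨ht0, ht1⟩) ht0
  simp only [add_zero, sub_zero, Real.one_rpow, mul_zero, sub_self] at h
  linarith

lemma two_add_mul_sq_le_rpow_add_rpow {p t : ℝ} (hp1 : 1 < p) (hp2 : p ≤ 2) (ht0 : 0 ≤ t)
    (ht1 : t ≤ 1) : 2 + p * (p - 1) * t ^ 2 ≤ (1 + t) ^ p + (1 - t) ^ p := by
  have hp0 : 0 < p := by linarith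
  have hmono : MonotoneOn (fun t : ℝ => (1 + t) ^ p + (1 - t) ^ p - p * (p - 1) * t ^ 2)
      (Set.Icc 0 1) := by
    refine monotoneOn_of_hasDerivWithinAt_nonneg
      (f' := fun u => p * ((1 + u) ^ (p - 1) - (1 - u) ^ (p - 1) - 2 * (p - 1) * u))
      (convex_Icc 0 1) ?_ (fun u _ => HasDerivAt.hasDerivWithinAt ?_) ?_
    · refine ContinuousOn.sub (ContinuousOn.add ?_ ?_) (by fun_prop)
      · exact ContinuousOn.rpow_const (by fun_prop) (fun _ _ => Or.inr hp0.le)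
      · exact ContinuousOn.rpow_const (by fun_prop) (fun _ _ => Or.inr hp0.le)
    · have h1 := ((hasDerivAt_id u).const_add 1).rpow_const (p := p) (Or.inr hp1.le)
      have h2 := ((hasDerivAt_id u).const_sub 1).rpow_const (p := p) (Or.inr hp1.le)
      have h3 := (hasDerivAt_pow 2 u).const_mul (p * (p - 1))
      refine ((h1.add h2).sub h3).congr_deriv ?_
      simp only [id]
      push_cast
      ring
    · intro u hu
      rw [interior_Icc] at hu
      have := two_mul_mul_le_rpow_sub_rpow (s := p - 1) (by linarith) (by linarith)
        hu.1.le hu.2.le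
      exact mul_nonneg hp0.le (by linarith)
  have h := hmono (by simp) (Set.mem_Icc.2 ⟨ht0, ht1⟩) ht0
  simp only [add_zero, sub_zero, Real.one_rpow, ne_eq, OfNat.ofNat_ne_zero, not_false_eq_true,
    zero_pow, mul_zero] at h
  linarith

/-- The two-point inequality behind the 2-uniform convexity of `ℓ_p`, for `0 ≤ b ≤ a`. -/
lemma two_point_of_le {p a b : ℝ} (hp1 : 1 < p) (hp2 : p ≤ 2) (hb : 0 ≤ b) (hab : b ≤ a) :
    (a ^ 2 + (p - 1) * b ^ 2) ^ (p / 2) ≤ (|a + b| ^ p + |a - b| ^ p) / 2 := by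
  have hp0 : 0 < p := by linarith
  rcases (hb.trans hab).eq_or_lt with ha | ha
  · obtain rfl : b = 0 := by linarith
    subst ha
    simp [Real.zero_rpow hp0.ne', Real.zero_rpow (div_pos hp0 two_pos).ne']
  obtain ⟨t, rfl⟩ : ∃ t, b = a * t := ⟨b / a, by field_simp⟩
  have ht0 : 0 ≤ t := nonneg_of_mul_nonneg_right hb ha
  have ht1 : t ≤ 1 := by
    by_contra! h
    nlinarith
  have e1 : |a + a * t| ^ p = a ^ p * (1 + t) ^ p := by
    rw [abs_of_nonneg (by positivity), ← Real.mul_rpow ha.le (by linarith)]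
    ring_nf
  have e2 : |a - a * t| ^ p = a ^ p * (1 - t) ^ p := by
    rw [abs_of_nonneg (by linarith), ← Real.mul_rpow ha.le (by linarith)]
    ring_nf
  have hz : 0 ≤ (p - 1) * t ^ 2 := mul_nonneg (by linarith) (by positivity)
  have e3 : (a ^ 2 + (p - 1) * (a * t) ^ 2) ^ (p / 2) =
      a ^ p * (1 + (p - 1) * t ^ 2) ^ (p / 2) := by
    rw [show a ^ 2 + (p - 1) * (a * t) ^ 2 = a ^ 2 * (1 + (p - 1) * t ^ 2) by ring,
      Real.mul_rpow (by positivity) (by linarith), ← Real.rpow_natCast_mul ha.le]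
    congr 2
    push_cast
    ring
  rw [e1, e2, e3]
  have hbern := rpow_one_add_le_one_add_mul_self (s := (p - 1) * t ^ 2) (p := p / 2)
    (by linarith) (by linarith) (by linarith)
  have h := two_add_mul_sq_le_rpow_add_rpow hp1 hp2 ht0 ht1
  have : (1 + (p - 1) * t ^ 2) ^ (p / 2) ≤ ((1 + t) ^ p + (1 - t) ^ p) / 2 := by linarith
  have := mul_le_mul_of_nonneg_left this (Real.rpow_nonneg ha.le p)
  linarith

lemma abs_add_rpow_add_abs_sub_rpow (p a b : ℝ) :
    |a + b| ^ p + |a - b| ^ p = |(|a| + |b|)| ^ p + |(|a| - |b|)| ^ p := by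
  rcases abs_cases a with ⟨h, _⟩ | ⟨h, _⟩ <;> rcases abs_cases b with ⟨h', _⟩ | ⟨h', _⟩ <;>
    rw [h, h']
  · rw [← sub_eq_add_neg, sub_neg_eq_add, add_comm]
  · rw [← abs_neg (-a + b), ← abs_neg (-a - b), add_comm]
    ring_nf
  · rw [← abs_neg (-a + -b), ← abs_neg (-a - -b)]
    ring_nf

lemma two_point {p : ℝ} (hp1 : 1 < p) (hp2 : p ≤ 2) (a b : ℝ) :
    (a ^ 2 + (p - 1) * b ^ 2) ^ (p / 2) ≤ (|a + b| ^ p + |a - b| ^ p) / 2 := by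
  rw [abs_add_rpow_add_abs_sub_rpow, ← sq_abs a, ← sq_abs b]
  rcases le_total |b| |a| with h | h
  · exact two_point_of_le hp1 hp2 (abs_nonneg b) h
  · have hswap := two_point_of_le hp1 hp2 (abs_nonneg a) h
    rw [add_comm |b| |a|, abs_sub_comm |b| |a|] at hswap
    refine le_trans (Real.rpow_le_rpow ?_ ?_ (by linarith)) hswap
    · nlinarith [sq_nonneg |a|, sq_nonneg |b|]
    · nlinarith [pow_le_pow_left₀ (abs_nonneg a) h 2]

lemma sum_rpow_eq_one_of_lpNorm_eq_one {p : ℝ} (hp : 0 < p) {q : ℕ} {x : Fin q → ℝ}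
    (hx : lpNorm p q x = 1) : ∑ i, |x i| ^ p = 1 := by
  have h0 : 0 ≤ ∑ i, |x i| ^ p :=
    Finset.sum_nonneg fun _ _ => Real.rpow_nonneg (abs_nonneg _) _
  rw [← Real.rpow_inv_rpow h0 hp.ne', ← one_div]
  unfold lpNorm at hx
  rw [hx, Real.one_rpow]

lemma sum_mul_sq_rpow {p : ℝ} (hp : 0 < p) {q : ℕ} (x : Fin q → ℝ) {c : ℝ} (hc : 0 ≤ c) :
    (∑ i, (c * x i ^ 2) ^ (p / 2)) ^ (2 / p) = c * lpNorm p q x ^ 2 := by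
  have h0 : 0 ≤ ∑ i, |x i| ^ p :=
    Finset.sum_nonneg fun _ _ => Real.rpow_nonneg (abs_nonneg _) _
  have h : ∀ i, (c * x i ^ 2) ^ (p / 2) = c ^ (p / 2) * |x i| ^ p := by
    intro i
    rw [Real.mul_rpow hc (sq_nonneg _), ← sq_abs, ← Real.rpow_natCast_mul (abs_nonneg _)]
    congr 2
    push_cast
    ring
  simp only [h, ← Finset.mul_sum]
  rw [Real.mul_rpow (Real.rpow_nonneg hc _) h0, ← Real.rpow_mul hc, lpNorm,
    ← Real.rpow_mul_natCast h0, show p / 2 * (2 / p) = 1 by field_simp, Real.rpow_one]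
  congr 2
  push_cast
  ring

/-- 2-uniform convexity of `ℓ_p` on the unit sphere, for `1 < p ≤ 2`. -/
lemma lpNorm_midpoint_sq_add_le {p : ℝ} (hp1 : 1 < p) (hp2 : p ≤ 2) {q : ℕ}
    {x y : Fin q → ℝ} (hx : lpNorm p q x = 1) (hy : lpNorm p q y = 1) :
    lpNorm p q ((x + y) / 2) ^ 2 + (p - 1) / 4 * lpNorm p q (x - y) ^ 2 ≤ 1 := by
  have hp0 : 0 < p := by linarith
  have hc : 0 ≤ (p - 1) / 4 := by linarith
  set A : Fin q → ℝ := fun i => 1 * ((x + y) / 2) i ^ 2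
  set B : Fin q → ℝ := fun i => (p - 1) / 4 * (x - y) i ^ 2
  have hA : ∀ i, 0 ≤ A i := fun i => by positivity
  have hB : ∀ i, 0 ≤ B i := fun i => by positivity
  have hmink := rpow_add_rpow_sum_le Finset.univ (fun i => A i ^ (p / 2))
    (fun i => B i ^ (p / 2)) (fun i => Real.rpow_nonneg (hA i) _)
    (fun i => Real.rpow_nonneg (hB i) _) (r := 2 / p) (by rwa [le_div_iff₀ hp0, one_mul])
  have hinv : ∀ z : ℝ, 0 ≤ z → (z ^ (p / 2)) ^ (2 / p) = z := by
    intro z hz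
    rw [← Real.rpow_mul hz, show p / 2 * (2 / p) = 1 by field_simp, Real.rpow_one]
  simp only [hinv _ (hA _), hinv _ (hB _), one_div_div] at hmink
  rw [sum_mul_sq_rpow hp0 _ zero_le_one, sum_mul_sq_rpow hp0 _ hc, one_mul] at hmink
  have hpt : ∀ i, (A i + B i) ^ (p / 2) ≤ (|x i| ^ p + |y i| ^ p) / 2 := by
    intro i
    have h := two_point hp1 hp2 ((x i + y i) / 2) ((x i - y i) / 2)
    have hAB : A i + B i = ((x i + y i) / 2) ^ 2 + (p - 1) * ((x i - y i) / 2) ^ 2 := by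
      simp only [A, B, Pi.div_apply, Pi.add_apply, Pi.sub_apply, Pi.ofNat_apply]
      ring
    rw [hAB]
    convert h using 5 <;> ring_nf
  have hsum : ∑ i, (A i + B i) ^ (p / 2) ≤ 1 := by
    refine (Finset.sum_le_sum fun i _ => hpt i).trans_eq ?_
    rw [← Finset.sum_div, Finset.sum_add_distrib, sum_rpow_eq_one_of_lpNorm_eq_one hp0 hx,
      sum_rpow_eq_one_of_lpNorm_eq_one hp0 hy]
    norm_num
  by_contra! h
  linarith [Real.one_lt_rpow h (show 0 < p / 2 by linarith)]

/-- modulus-of-convexity bound `δ_p(ε) ≥ ((p-1)/8) ε²` for `1 < p ≤ 2`. -/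
theorem stmt_12 (p : ℝ) (hp1 : 1 < p) (hp2 : p ≤ 2) (q : ℕ) (hq : 1 ≤ q)
    (x y : Fin q → ℝ) (hx : lpNorm p q x = 1) (hy : lpNorm p q y = 1)
    (ε : ℝ) (hε0 : 0 ≤ ε) (hε2 : ε ≤ 2) (hsep : ε ≤ lpNorm p q (x - y)) :
    ((p - 1) / 8) * ε ^ 2 ≤ 1 - lpNorm p q ((x + y) / 2) := by
  have h := lpNorm_midpoint_sq_add_le hp1 hp2 hx hy
  have hε := mul_le_mul_of_nonneg_left (pow_le_pow_left₀ hε0 hsep 2)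
    (show 0 ≤ (p - 1) / 4 by linarith)
  linarith [sq_nonneg (lpNorm p q ((x + y) / 2) - 1)]
end

section
/- Let p ∈ [2,∞) and q ≥ 1. For all x, y ∈ ℝ^q with ‖x‖_p = ‖y‖_p = 1 and all ε ∈ [0,2] with ‖x − y‖_p ≥ ε, one has 1 − ‖(x + y)/2‖_p ≥ ε^p / (p · 2^p); that is, the modulus of convexity of the ℓ_p norm satisfies δ_p(ε) ≥ ε^p / (p · 2^p). -/
theorem Real.abs_rpow_eq_sq_rpow (a p : ℝ) : |a| ^ p = (a ^ 2) ^ (p / 2) := by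
  rw [← sq_abs, ← Real.rpow_natCast, ← Real.rpow_mul (abs_nonneg a)]
  congr 1
  push_cast
  ring

/-- The scalar Clarkson inequality for exponents `p ≥ 2`. -/
theorem Real.clarkson_scalar {p : ℝ} (hp : 2 ≤ p) (a b : ℝ) :
    |(a + b) / 2| ^ p + |(a - b) / 2| ^ p ≤ (|a| ^ p + |b| ^ p) / 2 := by
  have hp1 : 1 ≤ p / 2 := by linarith
  simp only [Real.abs_rpow_eq_sq_rpow]
  have hsuper : (((a + b) / 2) ^ 2) ^ (p / 2) + (((a - b) / 2) ^ 2) ^ (p / 2) ≤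
      (((a + b) / 2) ^ 2 + ((a - b) / 2) ^ 2) ^ (p / 2) := by
    have h := NNReal.add_rpow_le_rpow_add
      ⟨((a + b) / 2) ^ 2, sq_nonneg _⟩ ⟨((a - b) / 2) ^ 2, sq_nonneg _⟩ hp1
    exact_mod_cast h
  have hconv := (convexOn_rpow hp1).2 (Set.mem_Ici.2 (sq_nonneg a)) (Set.mem_Ici.2 (sq_nonneg b))
    (by norm_num : (0 : ℝ) ≤ 1 / 2) (by norm_num : (0 : ℝ) ≤ 1 / 2) (by norm_num)
  simp only [smul_eq_mul] at hconv
  have heq : ((a + b) / 2) ^ 2 + ((a - b) / 2) ^ 2 = 1 / 2 * a ^ 2 + 1 / 2 * b ^ 2 := by ring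
  rw [heq] at hsuper
  linarith

/-- Clarkson's inequality for the `ℓ_p` norm with `p ≥ 2`. -/
theorem lpNorm_clarkson {p : ℝ} (hp : 2 ≤ p) (q : ℕ) (x y : Fin q → ℝ) :
    lpNorm p q ((x + y) / 2) ^ p + (lpNorm p q (x - y) / 2) ^ p ≤
      (lpNorm p q x ^ p + lpNorm p q y ^ p) / 2 := by
  have hp0 : p ≠ 0 := by linarith
  rw [Real.div_rpow (lpNorm_nonneg _ _ _) zero_le_two]
  simp only [lpNorm_rpow hp0]
  rw [Finset.sum_div, ← Finset.sum_add_distrib, ← Finset.sum_add_distrib, Finset.sum_div]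
  refine Finset.sum_le_sum fun i _ => ?_
  have h := Real.clarkson_scalar hp (x i) (y i)
  rw [abs_div (x i - y i), Real.div_rpow (abs_nonneg _) (abs_nonneg _), abs_two] at h
  exact h

/-- modulus-of-convexity bound `δ_p(ε) ≥ ε^p/(p·2^p)` for `p ≥ 2`. -/
theorem stmt_13 (p : ℝ) (hp : 2 ≤ p) (q : ℕ) (hq : 1 ≤ q)
    (x y : Fin q → ℝ) (hx : lpNorm p q x = 1) (hy : lpNorm p q y = 1)
    (ε : ℝ) (hε0 : 0 ≤ ε) (hε2 : ε ≤ 2) (hsep : ε ≤ lpNorm p q (x - y)) :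
    ε ^ p / (p * 2 ^ p) ≤ 1 - lpNorm p q ((x + y) / 2) := by
  have hp0 : 0 < p := by linarith
  have hclarkson := lpNorm_clarkson hp q x y
  rw [hx, hy, Real.one_rpow] at hclarkson
  have hmono : (ε / 2) ^ p ≤ (lpNorm p q (x - y) / 2) ^ p := by gcongr
  have hmid := lpNorm_nonneg p q ((x + y) / 2)
  have hbernoulli := one_add_mul_self_le_rpow_one_add
    (s := lpNorm p q ((x + y) / 2) - 1) (by linarith) (by linarith : 1 ≤ p)
  rw [add_sub_cancel] at hbernoulli
  rw [mul_comm p, ← div_div, ← Real.div_rpow hε0 zero_le_two, div_le_iff₀ hp0]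
  linarith
end

section
/- Let p ∈ (1,∞), q ≥ 1, let A ⊆ ℝ^q be a nonempty convex set, let v ∈ ℝ^q with v ∉ A, and suppose y' ∈ A satisfies ‖y' − v‖_p ≤ ‖y − v‖_p for all y ∈ A. Set z' := y' − v (so z' ≠ 0 if A is closed, and assume z' ≠ 0) and define w' ∈ ℝ^q componentwise by w'_i = |z'_i|^{p−1} sgn(z'_i) / ‖z'‖_p^{p−1}. Then the first-order optimality condition ⟨w', u − y'⟩ ≥ 0 holds for all u ∈ A, where ⟨·,·⟩ is the Euclidean inner product. -/
theorem abs_rpow_sub_one_mul_sign (p x : ℝ) :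
    |x| ^ (p - 1) * Real.sign x = |x| ^ (p - 2) * x := by
  rcases eq_or_ne x 0 with rfl | hx
  · simp
  · have h : |x| ^ (p - 1) = |x| ^ (p - 2) * |x| := by
      rw [← Real.rpow_add_one (abs_ne_zero.mpr hx)]
      ring_nf
    rcases hx.lt_or_gt with h' | h'
    · rw [h, Real.sign_of_neg h', abs_of_neg h']
      ring
    · rw [h, Real.sign_of_pos h', abs_of_pos h']
      ring

theorem sum_abs_rpow_le_of_lpNorm_le {p : ℝ} (hp : 0 < p) {q : ℕ} {x y : Fin q → ℝ}
    (h : lpNorm p q x ≤ lpNorm p q y) : ∑ i, |x i| ^ p ≤ ∑ i, |y i| ^ p :=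
  (Real.rpow_le_rpow_iff (by positivity) (by positivity) (one_div_pos.mpr hp)).mp h

theorem hasFDerivAt_sum_abs_sub_rpow {p : ℝ} (hp : 1 < p) {q : ℕ} (v y : Fin q → ℝ) :
    HasFDerivAt (fun y : Fin q → ℝ => ∑ i, |(y - v) i| ^ p)
      (∑ i, (p * |(y - v) i| ^ (p - 2) * (y - v) i) •
        ContinuousLinearMap.proj (R := ℝ) (φ := fun _ : Fin q => ℝ) i) y := by
  refine HasFDerivAt.fun_sum fun i _ => ?_
  have hcoord : HasFDerivAt (fun y : Fin q → ℝ => (y - v) i)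
      (ContinuousLinearMap.proj (R := ℝ) (φ := fun _ : Fin q => ℝ) i) y :=
    HasFDerivAt.sub_const (v i)
      (ContinuousLinearMap.proj (R := ℝ) (φ := fun _ : Fin q => ℝ) i).hasFDerivAt
  exact (hasDerivAt_abs_rpow ((y - v) i) hp).comp_hasFDerivAt y hcoord

/-- first-order optimality of the ℓ_p nearest-point problem:
the gradient of the ℓ_p norm at the optimal residual satisfies the support
condition at the nearest point. -/
theorem stmt_14 (p : ℝ) (hp : 1 < p) (q : ℕ) (hq : 1 ≤ q)
    (A : Set (Fin q → ℝ)) (hne : A.Nonempty) (hA : Convex ℝ A)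
    (v : Fin q → ℝ) (hv : v ∉ A)
    (y' : Fin q → ℝ) (hy' : y' ∈ A)
    (hmin : ∀ y ∈ A, lpNorm p q (y' - v) ≤ lpNorm p q (y - v))
    (hz : y' - v ≠ 0) (w' : Fin q → ℝ)
    (hw' : ∀ i : Fin q, w' i =
      |(y' - v) i| ^ (p - 1) * Real.sign ((y' - v) i) / (lpNorm p q (y' - v)) ^ (p - 1)) :
    ∀ u ∈ A, 0 ≤ inner2 q w' (u - y') := by
  intro u hu
  have hlocal : IsLocalMinOn (fun y : Fin q → ℝ => ∑ i, |(y - v) i| ^ p) A y' :=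
    IsMinOn.localize fun y hy =>
      sum_abs_rpow_le_of_lpNorm_le (zero_lt_one.trans hp) (hmin y hy)
  have hderiv := hlocal.hasFDerivWithinAt_nonneg
    (hasFDerivAt_sum_abs_sub_rpow hp v y').hasFDerivWithinAt
    (sub_mem_posTangentConeAt_of_segment_subset (hA.segment_subset hy' hu))
  have hscale : (∑ i, (p * |(y' - v) i| ^ (p - 2) * (y' - v) i) •
        ContinuousLinearMap.proj (R := ℝ) (φ := fun _ : Fin q => ℝ) i) (u - y') =
      p * ∑ i, |(y' - v) i| ^ (p - 2) * (y' - v) i * (u - y') i := by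
    simp [Finset.mul_sum, mul_assoc]
  rw [hscale] at hderiv
  have hinner : inner2 q w' (u - y') =
      (∑ i, |(y' - v) i| ^ (p - 2) * (y' - v) i * (u - y') i) /
        lpNorm p q (y' - v) ^ (p - 1) := by
    unfold inner2
    rw [Finset.sum_div]
    refine Finset.sum_congr rfl fun i _ => ?_
    rw [hw', abs_rpow_sub_one_mul_sign]
    ring
  rw [hinner]
  exact div_nonneg (nonneg_of_mul_nonneg_right hderiv (zero_lt_one.trans hp))
    (Real.rpow_nonneg (lpNorm_nonneg p q _) _)
end

section
/- Let p ∈ (1,∞), q ≥ 1, and r > 0. Let A ⊆ ℝ^q be a nonempty compact convex set, and let (P_k)_{k ≥ 0} be a sequence of nonempty compact sets in ℝ^q such that: P_0 ⊇ A; for every k ≥ 0 there exists w_k ∈ ℝ^q \ {0} such that P_{k+1} = P_k ∩ { y ∈ ℝ^q : ⟨w_k, y⟩ ≤ sup_{a ∈ A} ⟨w_k, a⟩ } (a supporting halfspace of A); and for every k ≥ 0, δ_H(P_k, P_{k+1}) ≥ r · δ_H(P_k, A), where δ_H denotes the Hausdorff distance induced by ‖·‖_p. Then lim_{k→∞} δ_H(P_k,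 A) = 0. -/
/-- Hausdorff distance between subsets of `Fin q → ℝ` induced by the ℓ_p norm. -/
noncomputable def hausdorffLp (p : ℝ) (q : ℕ) (A B : Set (Fin q → ℝ)) : ℝ :=
  max (⨆ a : A, ⨅ b : B, lpNorm p q ((a : Fin q → ℝ) - b))
      (⨆ b : B, ⨅ a : A, lpNorm p q ((a : Fin q → ℝ) - b))

theorem lpNorm_zero {p : ℝ} (hp : 0 < p) (q : ℕ) : lpNorm p q 0 = 0 := by
  simp [lpNorm, Real.zero_rpow hp.ne', Real.zero_rpow (inv_ne_zero hp.ne')]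

theorem continuous_lpNorm {p : ℝ} (hp : 0 < p) (q : ℕ) : Continuous (lpNorm p q) := by
  unfold lpNorm
  refine Continuous.rpow_const (continuous_finsetSum _ fun i _ => ?_)
    fun _ => Or.inr (by positivity)
  exact (continuous_apply i).abs.rpow_const fun _ => Or.inr hp.le

theorem hausdorffLp_nonneg (p : ℝ) (q : ℕ) (A B : Set (Fin q → ℝ)) :
    0 ≤ hausdorffLp p q A B :=
  le_max_of_le_left <| Real.iSup_nonneg fun _ => Real.iInf_nonneg fun _ => lpNorm_nonneg ..

theorem hausdorffLp_le {p : ℝ} {q : ℕ} {A B : Set (Fin q → ℝ)} {ε : ℝ} (hε : 0 ≤ ε)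
    (hA : ∀ a ∈ A, ∃ b ∈ B, lpNorm p q (a - b) ≤ ε)
    (hB : ∀ b ∈ B, ∃ a ∈ A, lpNorm p q (a - b) ≤ ε) :
    hausdorffLp p q A B ≤ ε := by
  refine max_le (Real.iSup_le (fun a => ?_) hε) (Real.iSup_le (fun b => ?_) hε)
  · obtain ⟨b, hb, h⟩ := hA a a.2
    exact (ciInf_le ⟨0, Set.forall_mem_range.2 fun _ => lpNorm_nonneg ..⟩ (⟨b, hb⟩ : B)).trans h
  · obtain ⟨a, ha, h⟩ := hB b b.2
    exact (ciInf_le ⟨0, Set.forall_mem_range.2 fun _ => lpNorm_nonneg ..⟩ (⟨a, ha⟩ : A)).trans h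

/-- Consecutive members of a decreasing sequence of compact sets get arbitrarily close. -/
theorem tendsto_hausdorffLp_succ {p : ℝ} (hp : 0 < p) {q : ℕ} {P : ℕ → Set (Fin q → ℝ)}
    (hP : Antitone P) (hPcomp : ∀ k, IsCompact (P k)) :
    Filter.Tendsto (fun k => hausdorffLp p q (P k) (P (k + 1))) Filter.atTop (nhds 0) := by
  refine tendsto_order.2 ⟨fun a ha => .of_forall fun k => ha.trans_le (hausdorffLp_nonneg ..),
    fun ε hε => ?_⟩
  let U : Set (Fin q → ℝ) := ⋃ b ∈ ⋂ k, P k, {a | lpNorm p q (a - b) < ε / 2}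
  have hU : IsOpen U := isOpen_biUnion fun b _ =>
    isOpen_lt ((continuous_lpNorm hp q).comp (continuous_id.sub continuous_const)) continuous_const
  have hsub : ⋂ k, P k ⊆ U := fun a ha =>
    Set.mem_biUnion ha (by simpa [lpNorm_zero hp] using hε)
  obtain ⟨n, hn⟩ := exists_subset_nhds_of_isCompact hP.directed_ge hPcomp
    fun x hx => hU.mem_nhds (hsub hx)
  filter_upwards [Filter.eventually_ge_atTop n] with k hk
  refine (hausdorffLp_le (half_pos hε).le (fun a ha => ?_) fun b hb => ?_).trans_lt
    (half_lt_self hε)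
  · obtain ⟨b, hb, h⟩ := Set.mem_iUnion₂.1 (hn (hP hk ha))
    exact ⟨b, Set.mem_iInter.1 hb _, le_of_lt h⟩
  · exact ⟨b, hP k.le_succ hb, by simpa [lpNorm_zero hp] using (half_pos hε).le⟩

/-- convergence of `H(r,A)`-sequences of cutting: if each cut is a
supporting halfspace of `A` and captures at least the fraction `r` of the current
Hausdorff error, then the Hausdorff error tends to zero. -/
theorem stmt_16 (p : ℝ) (hp : 1 < p) (q : ℕ) (hq : 1 ≤ q) (r : ℝ) (hr : 0 < r)
    (A : Set (Fin q → ℝ)) (hAne : A.Nonempty) (hAcomp : IsCompact A) (hAconv : Convex ℝ A)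
    (P : ℕ → Set (Fin q → ℝ))
    (hPne : ∀ k, (P k).Nonempty) (hPcomp : ∀ k, IsCompact (P k))
    (hP0 : A ⊆ P 0)
    (hcut : ∀ k, ∃ w : Fin q → ℝ, w ≠ 0 ∧
      P (k + 1) = P k ∩ {y : Fin q → ℝ | inner2 q w y ≤ ⨆ a : A, inner2 q w a})
    (hH : ∀ k, r * hausdorffLp p q (P k) A ≤ hausdorffLp p q (P k) (P (k + 1))) :
    Filter.Tendsto (fun k => hausdorffLp p q (P k) A) Filter.atTop (nhds 0) := by
  have hP : Antitone P := antitone_nat_of_succ_le fun k => by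
    obtain ⟨w, -, h⟩ := hcut k
    exact h ▸ Set.inter_subset_left
  have hlim := (tendsto_hausdorffLp_succ (zero_lt_one.trans hp) hP hPcomp).div_const r
  rw [zero_div] at hlim
  exact squeeze_zero (fun k => hausdorffLp_nonneg ..)
    (fun k => (le_div_iff₀' hr).2 (hH k)) hlim
end
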